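/- Let f : ℝ^d → ℝ be continuously differentiable, bounded below with infimum f_*, and μ-PL, i.e. ‖∇f(x)‖₂² ≥ 2μ(f(x) − f_*) for all x. Let ℓ, B > 0, let Σ_1, …, Σ_N ∈ ℝ^{d×d} be diagonal positive-definite matrices with diagonal entries at most σ_i², and let σ_{H,1} be the harmonic mean of (σ_i). If X : [0,∞) → ℝ^d is differentiable and satisfies X'(t) = −ℓ·√B·((1/N)∑_{i=1}^N Σ_i^{-1/2})·∇f(X(t)), then for all t ≥ 0: f(X(t)) − f_* ≤ (f(X(0)) − f_*)·e^{−2μ·ℓ·√B·σ_{H,1}^{-1}·t}. -/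

import Mathlib

open Matrix

/-- Exponential decay from the differential inequality `h' ≤ -c h` on `[0, ∞)`. -/
theorem le_mul_exp_of_hasDerivAt_le {h h' : ℝ → ℝ} {c : ℝ}
    (hh : ∀ t, 0 ≤ t → HasDerivAt h (h' t) t) (hle : ∀ t, 0 ≤ t → h' t ≤ -c * h t)
    {t : ℝ} (ht : 0 ≤ t) : h t ≤ h 0 * Real.exp (-c * t) := by
  have hd : ∀ s, 0 ≤ s → HasDerivAt (fun s => h s * Real.exp (c * s))
      (h' s * Real.exp (c * s) + h s * (Real.exp (c * s) * c)) s := fun s hs => by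
    have := ((hasDerivAt_id s).const_mul c).exp
    simp only [id, mul_one] at this
    exact (hh s hs).mul this
  have hanti : AntitoneOn (fun s => h s * Real.exp (c * s)) (Set.Ici 0) := by
    refine antitoneOn_of_deriv_nonpos (convex_Ici 0)
      (fun s hs => (hd s hs).continuousAt.continuousWithinAt) ?_ ?_
    · intro s hs
      rw [interior_Ici] at hs
      exact (hd s (le_of_lt hs)).differentiableAt.differentiableWithinAt
    · intro s hs
      rw [interior_Ici] at hs
      rw [(hd s (le_of_lt hs)).deriv]
      nlinarith [hle s (le_of_lt hs), Real.exp_pos (c * s)]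
  have key := hanti Set.self_mem_Ici (Set.mem_Ici.2 ht) ht
  simp only [mul_zero, Real.exp_zero, mul_one] at key
  rw [neg_mul, Real.exp_neg, ← div_eq_mul_inv, le_div_iff₀ (Real.exp_pos _)]
  exact key

/-- A diagonal quadratic form with entries at least `c` dominates `c ‖x‖²`. -/
theorem EuclideanSpace.mul_norm_sq_le_sum_mul_sq {ι : Type*} [Fintype ι]
    (x : EuclideanSpace ℝ ι) {p : ι → ℝ} {c : ℝ} (hp : ∀ j, c ≤ p j) :
    c * ‖x‖ ^ 2 ≤ ∑ j, p j * x j ^ 2 := by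
  rw [EuclideanSpace.real_norm_sq_eq, Finset.mul_sum]
  exact Finset.sum_le_sum fun j _ => mul_le_mul_of_nonneg_right (hp j) (sq_nonneg _)

/-- Phase 3 of Theorem 3.12 (noiseless drift): along the preconditioned gradient
flow `X' = −ℓ√B ((1/N)∑ Σ_i^{-1/2}) ∇f(X)` with diagonal `Σ_i = diagonal (v i)`
having entries at most `σ_i²`, a μ-PL function converges exponentially at rate
`2 μ ℓ √B σ_{H,1}^{-1}`, where `σ_{H,1}^{-1} = (1/N)∑ 1/σ_i`. -/
theorem dsignsgd_phase3_drift
    (d N : ℕ) (hN : 0 < N)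
    (f : EuclideanSpace ℝ (Fin d) → ℝ) (hf : ContDiff ℝ 1 f)
    (fstar : ℝ) (hglb : IsGLB (Set.range f) fstar)
    (μ : ℝ) (hμ : 0 < μ)
    (hPL : ∀ x : EuclideanSpace ℝ (Fin d),
      2 * μ * (f x - fstar) ≤ ‖gradient f x‖ ^ 2)
    (ℓ B : ℝ) (hℓ : 0 < ℓ) (hB : 0 < B)
    (v : Fin N → Fin d → ℝ) (σ : Fin N → ℝ)
    (hσ : ∀ i, 0 < σ i)
    (hv : ∀ i j, 0 < v i j) (hvle : ∀ i j, v i j ≤ (σ i) ^ 2)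
    (X : ℝ → EuclideanSpace ℝ (Fin d))
    (hX : ∀ t : ℝ, 0 ≤ t →
      HasDerivAt X
        ((WithLp.equiv 2 (Fin d → ℝ)).symm
          (-((ℓ * Real.sqrt B) •
            ((1 / (N : ℝ)) •
              ∑ i, (Matrix.diagonal fun j => (Real.sqrt (v i j))⁻¹).mulVec
                ((WithLp.equiv 2 (Fin d → ℝ)) (gradient f (X t))))))) t) :
    ∀ t : ℝ, 0 ≤ t →
      f (X t) - fstar
        ≤ (f (X 0) - fstar) *
            Real.exp (-(2 * μ * ℓ * Real.sqrt B *
              ((1 / (N : ℝ)) * ∑ i, (σ i)⁻¹)) * t) := by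
  set S : ℝ := (1 / (N : ℝ)) * ∑ i, (σ i)⁻¹ with hS
  have hp : ∀ j, S ≤ (1 / (N : ℝ)) * ∑ i, (Real.sqrt (v i j))⁻¹ := fun j => by
    refine mul_le_mul_of_nonneg_left (Finset.sum_le_sum fun i _ => ?_) (by positivity)
    exact inv_anti₀ (Real.sqrt_pos.2 (hv i j))
      (Real.sqrt_le_iff.2 ⟨(hσ i).le, hvle i j⟩)
  have hS0 : 0 ≤ S :=
    mul_nonneg (by positivity) (Finset.sum_nonneg fun i _ => inv_nonneg.2 (hσ i).le)
  have hchain := fun t ht =>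
    ((((hf.differentiable one_ne_zero) (X t)).hasGradientAt.hasFDerivAt.comp_hasDerivAt t
      (hX t ht)).sub_const fstar)
  intro t ht
  refine le_mul_exp_of_hasDerivAt_le (h := fun s => f (X s) - fstar) hchain ?_ ht
  intro s _
  have hinner : (InnerProductSpace.toDual ℝ (EuclideanSpace ℝ (Fin d))) (gradient f (X s))
      ((WithLp.equiv 2 (Fin d → ℝ)).symm
        (-((ℓ * Real.sqrt B) • ((1 / (N : ℝ)) •
          ∑ i, (Matrix.diagonal fun j => (Real.sqrt (v i j))⁻¹).mulVec
            ((WithLp.equiv 2 (Fin d → ℝ)) (gradient f (X s)))))))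
      = -(ℓ * Real.sqrt B * ∑ j, ((1 / (N : ℝ)) * ∑ i, (Real.sqrt (v i j))⁻¹) *
          gradient f (X s) j ^ 2) := by
    rw [InnerProductSpace.toDual_apply_apply, PiLp.inner_apply, Finset.mul_sum,
      ← Finset.sum_neg_distrib]
    refine Finset.sum_congr rfl fun j _ => ?_
    simp [Matrix.mulVec_diagonal, Finset.sum_apply, ← Finset.sum_mul]
    ring
  have hcoef : 0 ≤ ℓ * Real.sqrt B := by positivity
  have hquad := mul_le_mul_of_nonneg_left
    (EuclideanSpace.mul_norm_sq_le_sum_mul_sq (gradient f (X s)) hp) hcoef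
  have hdecay := mul_le_mul_of_nonneg_left (hPL (X s)) (mul_nonneg hcoef hS0)
  rw [hinner]
  linarith
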